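/- (Whyburn's criterion, one direction) Let E be a closed, connected, locally connected subset of the Riemann sphere. Then for every ε > 0, only finitely many connected components of the complement of E have spherical diameter exceeding ε. -/

import Mathlib

open Set Filter Topology



lemma two_pi_gap {z : ℂ} (hz : Complex.exp z = 1) (h : ‖z‖ < 2 * Real.pi) : z = 0 := by
  obtain ⟨n, hn⟩ := Complex.exp_eq_one_iff.1 hz
  have hn0 : n = 0 := by
    by_contra hne
    have h1 : (1:ℝ) ≤ |(n:ℝ)| := by exact_mod_cast Int.one_le_abs hne
    have : ‖z‖ = |(n:ℝ)| * (2 * Real.pi) := by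
      rw [hn]; simp [abs_of_pos Real.pi_pos]
    nlinarith [Real.pi_pos]
  simp [hn, hn0]

/-- locally constant principle on preconnected sets -/
lemma const_of_exp_eq {X : Type*} [TopologicalSpace X] {F : Set X} (hF : IsPreconnected F)
    {f : X → ℂ} (hf : ContinuousOn f F) {w : ℂ} (h : ∀ x ∈ F, Complex.exp (f x) = w)
    {x y : X} (hx : x ∈ F) (hy : y ∈ F) : f x = f y := by
  refine hF.induction₂ (fun x y => f x = f y) ?_ (fun _ _ _ _ _ _ h1 h2 => h1.trans h2)
    (fun _ _ _ _ h => h.symm) hx hy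
  intro x hx
  have h1 : ∀ᶠ y in 𝓝[F] x, dist (f y) (f x) < 2 * Real.pi :=
    Metric.tendsto_nhds.1 (hf x hx) _ (by positivity)
  filter_upwards [h1, self_mem_nhdsWithin] with y hy hyF
  rw [dist_eq_norm] at hy
  have := two_pi_gap (z := f y - f x) (by
    rw [Complex.exp_sub, h y hyF, h x hx, div_self]
    rw [← h x hx]; exact Complex.exp_ne_zero _) hy
  exact (sub_eq_zero.1 this).symm

lemma exists_gap {T : Set ℝ} (hT : IsClosed T) {g : ℝ → ℂ} (hg : ContinuousOn g T)
    (h1 : ∀ t ∈ T, Complex.exp (g t) = 1) {t0 t1 : ℝ} (h01 : t0 ≤ t1) (ht0 : t0 ∈ T) (ht1 : t1 ∈ T)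
    (hne : g t0 ≠ g t1) :
    ∃ s s', s < s' ∧ s ∈ T ∧ s' ∈ T ∧ (∀ t ∈ Ioo s s', t ∉ T) ∧ g s ≠ g s' := by
  by_contra! hcon
  apply hne
  have hcl : IsClosed (T ∩ g ⁻¹' {g t0}) := hg.preimage_isClosed_of_isClosed hT isClosed_singleton
  set A := (T ∩ g ⁻¹' {g t0}) ∩ Icc t0 t1 with hA
  have hAc : IsClosed A := hcl.inter isClosed_Icc
  have hAne : A.Nonempty := ⟨t0, ⟨ht0, rfl⟩, le_refl _, h01⟩
  have hAb : BddAbove A := ⟨t1, fun x hx => hx.2.2⟩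
  have hs := hAc.csSup_mem hAne hAb
  set s := sSup A with hsdef
  rcases eq_or_lt_of_le hs.2.2 with h | hlt
  · rw [← h]; exact hs.1.2.symm
  exfalso
  set B := T ∩ Icc s t1 with hB
  -- right neighbourhood
  have hloc : ∀ᶠ y in 𝓝[T] s, g y = g s := by
    have h2 : ∀ᶠ y in 𝓝[T] s, dist (g y) (g s) < 2 * Real.pi :=
      Metric.tendsto_nhds.1 (hg s hs.1.1) _ (by positivity)
    filter_upwards [h2, self_mem_nhdsWithin] with y hy hyF
    rw [dist_eq_norm] at hy
    exact sub_eq_zero.1 (two_pi_gap (by rw [Complex.exp_sub, h1 y hyF, h1 s hs.1.1]; simp) hy)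
  obtain ⟨e, he, hball⟩ := Metric.mem_nhdsWithin_iff.1 hloc
  have hgs : g s = g t0 := hs.1.2
  have hno : ∀ y ∈ T, s < y → y ≤ t1 → g y ≠ g t0 := fun y hy hsy hyt hgy =>
    absurd (le_csSup hAb (show y ∈ A from ⟨⟨hy, hgy⟩, hs.2.1.trans hsy.le, hyt⟩)) (not_le.2 hsy)
  have hno2 : ∀ y ∈ T, s < y → y ≤ t1 → s + e ≤ y := by
    intro y hy hsy hyt
    by_contra! hlt'
    refine hno y hy hsy hyt ((hball ⟨?_, hy⟩).trans hgs)
    rw [Metric.mem_ball, Real.dist_eq, abs_lt]; constructor <;> linarith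
  set D := T ∩ Icc (s + e) t1 with hD
  have hDc : IsClosed D := hT.inter isClosed_Icc
  have hDne : D.Nonempty := ⟨t1, ht1, hno2 t1 ht1 hlt le_rfl, le_rfl⟩
  have hDb : BddBelow D := ⟨s + e, fun x hx => hx.2.1⟩
  have hs' := hDc.csInf_mem hDne hDb
  set s' := sInf D
  have hss : s < s' := by linarith [hs'.2.1]
  refine hno s' hs'.1 hss hs'.2.2 ((hcon s s' hss hs.1.1 hs'.1 ?_).symm.trans hgs)
  intro t ht htT
  have h3 := hno2 t htT ht.1 (ht.2.le.trans hs'.2.2)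
  exact absurd (csInf_le hDb (show t ∈ D from ⟨htT, h3, ht.2.le.trans hs'.2.2⟩)) (not_le.2 ht.2)

lemma ulc {X : Type*} [MetricSpace X] [CompactSpace X] {E : Set X} (hE : IsClosed E)
    (hlc : LocallyConnectedSpace E) {η : ℝ} (hη : 0 < η) :
    ∃ δ > 0, ∀ e ∈ E, ∀ e' ∈ E, dist e e' < δ → ∃ F ⊆ E, IsPreconnected F ∧ e ∈ F ∧ e' ∈ F ∧
      ∀ x ∈ F, dist x e < η := by
  have : CompactSpace E := isCompact_iff_compactSpace.1 hE.isCompact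
  have h := fun x : E => locallyConnectedSpace_iff_subsets_isOpen_isConnected.1 hlc x
    (Metric.ball x (η / 2)) (Metric.ball_mem_nhds x (by positivity))
  choose V hVb hVo hxV hVc using h
  obtain ⟨δ, hδ, hL⟩ := lebesgue_number_lemma_of_metric (isCompact_univ (X := E)) hVo
    (fun x _ => mem_iUnion.2 ⟨x, hxV x⟩)
  refine ⟨δ, hδ, fun e he e' he' hd => ?_⟩
  obtain ⟨i, hi⟩ := hL ⟨e, he⟩ (mem_univ _)
  have hei : (⟨e, he⟩ : E) ∈ V i := hi (Metric.mem_ball_self hδ)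
  have hei' : (⟨e', he'⟩ : E) ∈ V i := hi (by rw [Metric.mem_ball, dist_comm]; exact hd)
  refine ⟨Subtype.val '' V i, by simp, (hVc i).isPreconnected.image _ continuous_subtype_val.continuousOn,
    ⟨_, hei, rfl⟩, ⟨_, hei', rfl⟩, ?_⟩
  rintro _ ⟨x, hx, rfl⟩
  have h1 := hVb i hx
  have h2 := hVb i hei
  rw [Metric.mem_ball] at h1 h2
  have := dist_triangle_right x ⟨e, he⟩ i
  have h3 : dist (x : X) e = dist x ⟨e, he⟩ := rfl
  linarith

lemma periodic_unif {X : Type*} [MetricSpace X] {m : ℝ → X} (hm : Continuous m) {p : ℝ} (hp : 0 < p)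
    (hper : Function.Periodic m p) {δ : ℝ} (hδ : 0 < δ) :
    ∃ d > 0, ∀ s s', |s - s'| < d → dist (m s) (m s') < δ := by
  have h := (isCompact_Icc (a := (0:ℝ)) (b := p)).uniformContinuousAt_of_continuousAt m
    (fun t _ => hm.continuousAt) (Metric.dist_mem_uniformity hδ)
  obtain ⟨d, hd, hd'⟩ := Metric.mem_uniformity_dist.1 h
  refine ⟨d, hd, fun s s' hs => ?_⟩
  have h1 := toIcoMod_mem_Ico hp 0 s
  rw [zero_add] at h1
  have h2 : toIcoMod hp 0 s = s - toIcoDiv hp 0 s • p := rfl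
  have h3 : dist (m (s - toIcoDiv hp 0 s • p)) (m (s' - toIcoDiv hp 0 s • p)) < δ :=
    hd' (by rw [Real.dist_eq, sub_sub_sub_cancel_right]; exact hs) (by rw [← h2]; exact ⟨h1.1, h1.2.le⟩)
  have h4 := fun x => hper.sub_zsmul_eq (x := x) (toIcoDiv hp 0 s)
  rwa [h4, h4] at h3

lemma slit_ratio {z w : ℂ} (h : ‖z - w‖ < ‖w‖) : z / w ∈ Complex.slitPlane := by
  have hw : w ≠ 0 := by rintro rfl; simp at h; linarith [norm_nonneg z]
  have : z / w = 1 + (z - w) / w := by field_simp; ring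
  rw [this]
  apply Complex.mem_slitPlane_of_norm_lt_one
  rw [norm_div, div_lt_one (norm_pos_iff.2 hw)]; exact h

lemma log_transfer {X : Type*} [TopologicalSpace X] {K : Set X} {f g : X → ℂ}
    (hf : ContinuousOn f K) (hg : ContinuousOn g K) (hfg : ∀ x ∈ K, ‖f x - g x‖ < ‖g x‖)
    (h : ∃ L : X → ℂ, ContinuousOn L K ∧ ∀ x ∈ K, Complex.exp (L x) = g x) :
    ∃ L : X → ℂ, ContinuousOn L K ∧ ∀ x ∈ K, Complex.exp (L x) = f x := by
  obtain ⟨L, hL, hL'⟩ := h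
  have hg0 : ∀ x ∈ K, g x ≠ 0 := fun x hx => by rw [← hL' x hx]; exact Complex.exp_ne_zero _
  refine ⟨fun x => L x + Complex.log (f x / g x),
    hL.add ((hf.div hg hg0).clog fun x hx => slit_ratio (hfg x hx)), fun x hx => ?_⟩
  rw [Complex.exp_add, hL' x hx, Complex.exp_log (Complex.slitPlane_ne_zero (slit_ratio (hfg x hx)))]
  field_simp [hg0 x hx]

lemma log_transfer' {X : Type*} [TopologicalSpace X] {K : Set X} {f g : X → ℂ}
    (hf : ContinuousOn f K) (hg : ContinuousOn g K) (hfg : ∀ x ∈ K, ‖f x - g x‖ < ‖g x‖)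
    (h : ∃ L : X → ℂ, ContinuousOn L K ∧ ∀ x ∈ K, Complex.exp (L x) = f x) :
    ∃ L : X → ℂ, ContinuousOn L K ∧ ∀ x ∈ K, Complex.exp (L x) = g x := by
  obtain ⟨L, hL, hL'⟩ := h
  have hs := fun x hx => slit_ratio (hfg x hx)
  have hg0 : ∀ x ∈ K, g x ≠ 0 := fun x hx h0 => by
    have := hs x hx; rw [h0, div_zero] at this; exact Complex.slitPlane_ne_zero this rfl
  have hf0 : ∀ x ∈ K, f x ≠ 0 := fun x hx => by rw [← hL' x hx]; exact Complex.exp_ne_zero _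
  refine ⟨fun x => L x - Complex.log (f x / g x),
    hL.sub ((hf.div hg hg0).clog hs), fun x hx => ?_⟩
  rw [Complex.exp_sub, hL' x hx, Complex.exp_log (Complex.slitPlane_ne_zero (hs x hx))]
  field_simp [hg0 x hx, hf0 x hx]

/-- If a connected open set `C` joins the inside to the outside of an annulus, then the
coordinate `a` has a continuous logarithm on the part of the annulus outside `C`. -/
lemma exists_log {X : Type*} [MetricSpace X] [CompactSpace X] {a : X → ℂ} {N : X}
    (haN : a N = 0) (hac : ContinuousOn a {N}ᶜ) (hinj : InjOn a {N}ᶜ)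
    (hinf : ∀ R : ℝ, ∀ᶠ x in 𝓝[≠] N, R < ‖a x‖) {ρ R : ℝ} (hρ : 0 < ρ)
    {C : Set X} (hCo : IsOpen C) (hC : IsPreconnected C)
    (hu : ∃ u ∈ C, u ≠ N ∧ ‖a u‖ < ρ) (hv : ∃ v ∈ C, v = N ∨ R < ‖a v‖) :
    ∃ L : X → ℂ, ContinuousOn L {x | x ∉ C ∧ ρ ≤ ‖a x‖ ∧ ‖a x‖ ≤ R} ∧
      ∀ x ∈ {x | x ∉ C ∧ ρ ≤ ‖a x‖ ∧ ‖a x‖ ≤ R}, Complex.exp (L x) = a x := by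
  set K := {x | x ∉ C ∧ ρ ≤ ‖a x‖ ∧ ‖a x‖ ≤ R} with hK
  have hKN : K ⊆ {N}ᶜ := by
    rintro x hx rfl
    have := hx.2.1; rw [haN, norm_zero] at this; linarith
  have hacK : ContinuousOn a K := hac.mono hKN
  have hat : ∀ x, x ≠ N → ContinuousAt a x := fun x hx =>
    hac.continuousAt (isOpen_compl_singleton.mem_nhds hx)
  have hKc : IsClosed K := by
    rw [isClosed_iff_frequently]
    intro x hx
    have hxC : x ∉ C := fun h => by
      obtain ⟨y, hy, hy'⟩ := (hx.and_eventually (hCo.mem_nhds h)).exists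
      exact hy.1 hy'
    have hxN : x ≠ N := by
      rintro rfl
      have := eventually_nhdsWithin_iff.1 (hinf R)
      obtain ⟨y, hy, hy'⟩ := (hx.and_eventually this).exists
      exact absurd (hy' (hKN hy)) (not_lt.2 hy.2.2)
    refine ⟨hxC, ?_, ?_⟩
    · by_contra! h
      obtain ⟨y, hy, hy'⟩ := (hx.and_eventually ((hat x hxN).norm.eventually_lt_const h)).exists
      exact absurd hy' (not_lt.2 hy.2.1)
    · by_contra! h
      obtain ⟨y, hy, hy'⟩ := (hx.and_eventually ((hat x hxN).norm.eventually_const_lt h)).exists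
      exact absurd hy' (not_lt.2 hy.2.2)
  have hKcomp : IsCompact K := hKc.isCompact
  let P : X → Prop := fun u => u = N ∨
    ∃ L : X → ℂ, ContinuousOn L K ∧ ∀ x ∈ K, Complex.exp (L x) = a x - a u
  have hcs : ∀ u, ContinuousOn (fun x => a x - a u) K := fun u => hacK.sub continuousOn_const
  have hbig : ∀ v, R < ‖a v‖ → P v := by
    intro v hv
    right
    refine log_transfer (g := fun _ => - a v) (hcs v) continuousOn_const ?_
      ⟨fun _ => Complex.log (- a v), continuousOn_const, fun x hx => Complex.exp_log ?_⟩
    · intro x hx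
      have := hx.2.2
      simp only [sub_neg_eq_add, sub_add_cancel, norm_neg]; linarith
    · have := hx.2.1.trans hx.2.2
      rw [neg_ne_zero, ← norm_pos_iff]; linarith
  obtain ⟨u, huC, huN, hua⟩ := hu
  obtain ⟨v, hvC, hv⟩ := hv
  have hPv : P v := hv.elim Or.inl (hbig v)
  have key : P u ↔ P v := by
    refine hC.induction₂ (fun x y => P x ↔ P y) ?_ (fun _ _ _ _ _ _ h1 h2 => h1.trans h2)
      (fun _ _ _ _ h => h.symm) huC hvC
    intro x hx
    by_cases hxN : x = N
    · subst hxN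
      have := eventually_nhdsWithin_iff.1 (hinf R)
      filter_upwards [nhdsWithin_le_nhds this] with y hy
      refine iff_of_true (Or.inl rfl) ?_
      by_cases hyx : y = x
      · exact Or.inl hyx
      · exact hbig y (hy hyx)
    · have hpos : ∃ d > 0, ∀ y ∈ K, d ≤ ‖a y - a x‖ := by
        rcases K.eq_empty_or_nonempty with h | h
        · exact ⟨1, one_pos, by simp [h]⟩
        · obtain ⟨y, hy, hmin⟩ := hKcomp.exists_isMinOn h (hcs x).norm
          refine ⟨‖a y - a x‖, norm_pos_iff.2 (sub_ne_zero.2 fun h => ?_), fun z hz => hmin hz⟩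
          exact hy.1 (hinj (hKN hy) hxN h ▸ hx)
      obtain ⟨d, hd, hd'⟩ := hpos
      have h1 : ∀ᶠ y in 𝓝 x, dist (a y) (a x) < d := Metric.tendsto_nhds.1 (hat x hxN) d hd
      have h2 : ∀ᶠ y in 𝓝 x, y ≠ N := isOpen_compl_singleton.mem_nhds hxN
      filter_upwards [nhdsWithin_le_nhds h1, nhdsWithin_le_nhds h2] with y hy hyN
      have hfg : ∀ z ∈ K, ‖(a z - a y) - (a z - a x)‖ < ‖a z - a x‖ := by
        intro z hz
        rw [sub_sub_sub_cancel_left, ← dist_eq_norm, dist_comm]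
        exact hy.trans_le (hd' z hz)
      constructor
      · rintro (h | h)
        · exact absurd h hxN
        · exact Or.inr (log_transfer (hcs y) (hcs x) hfg h)
      · rintro (h | h)
        · exact absurd h hyN
        · exact Or.inr (log_transfer' (hcs y) (hcs x) hfg h)
  obtain h | h := key.2 hPv
  · exact absurd h huN
  · refine log_transfer' (hcs u) hacK (fun x hx => ?_) h
    have := hx.2.1
    simp only [sub_sub_cancel_left, norm_neg]; linarith

lemma core {X : Type*} [MetricSpace X] [CompactSpace X] [LocallyConnectedSpace X] {a : X → ℂ} {N : X}
    (haN : a N = 0) (hac : ContinuousOn a {N}ᶜ) (hinj : InjOn a {N}ᶜ)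
    (hinf : ∀ R : ℝ, ∀ᶠ x in 𝓝[≠] N, R < ‖a x‖) {ρ c R : ℝ} (hρ : 0 < ρ) (hρc : ρ < c) (hcR : c < R)
    {m : ℝ → X} (hm : Continuous m) (ham : ∀ t : ℝ, a (m t) = c * Complex.exp (t * Complex.I))
    {E : Set X} (hE : IsClosed E) (hlc : LocallyConnectedSpace E) :
    {C : Set X | (∃ x ∈ Eᶜ, C = connectedComponentIn Eᶜ x) ∧
      (∃ u ∈ C, u ≠ N ∧ ‖a u‖ < ρ) ∧ (∃ v ∈ C, v = N ∨ R < ‖a v‖)}.Finite := by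
  have hc : 0 < c := hρ.trans hρc
  have hnm : ∀ t, ‖a (m t)‖ = c := fun t => by
    rw [ham, norm_mul, Complex.norm_exp_ofReal_mul_I, mul_one, Complex.norm_real,
      Real.norm_of_nonneg hc.le]
  have hmN : ∀ t, m t ≠ N := fun t h => by
    have := hnm t; rw [h, haN, norm_zero] at this; linarith
  have hper : Function.Periodic m (2 * Real.pi) := fun t => by
    apply hinj (hmN _) (hmN _)
    rw [ham, ham]
    push_cast
    rw [add_mul, Complex.exp_add, Complex.exp_two_pi_mul_I, mul_one]
  have hat : ∀ x, x ≠ N → ContinuousAt a x := fun x hx =>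
    hac.continuousAt (isOpen_compl_singleton.mem_nhds hx)
  -- uniform neighbourhood of the circle
  obtain ⟨τ, hτ, hτ1, hτ2, hτ3⟩ : ∃ τ > 0, τ ≤ c ∧ τ ≤ c - ρ ∧ τ ≤ R - c :=
    ⟨min (c - ρ) (R - c), lt_min (by linarith) (by linarith), (min_le_left _ _).trans (by linarith),
      min_le_left _ _, min_le_right _ _⟩
  have hMc : IsCompact (m '' Icc 0 (2 * Real.pi)) := isCompact_Icc.image hm
  have hrange : ∀ t, m t ∈ m '' Icc 0 (2 * Real.pi) := fun t => by
    have h1 := toIcoMod_mem_Ico Real.two_pi_pos 0 t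
    rw [zero_add] at h1
    refine ⟨_, ⟨h1.1, h1.2.le⟩, hper.sub_zsmul_eq (x := t) (toIcoDiv Real.two_pi_pos 0 t)⟩
  obtain ⟨η, hη, hη'⟩ := Metric.mem_uniformity_dist.1 (hMc.uniformContinuousAt_of_continuousAt a
    (by rintro _ ⟨t, _, rfl⟩; exact hat _ (hmN t)) (Metric.dist_mem_uniformity hτ))
  have hnear : ∀ t x, dist x (m t) < η → ‖a x - a (m t)‖ < τ := fun t x hx => by
    have := hη' (a := m t) (b := x) (by rwa [dist_comm]) (hrange t)
    simp only [mem_ofPred_eq] at this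
    rwa [dist_comm, dist_eq_norm] at this
  obtain ⟨δ, hδ, hF⟩ := ulc hE hlc hη
  obtain ⟨d, hd, hdm⟩ := periodic_unif hm Real.two_pi_pos hper hδ
  obtain ⟨n, hn⟩ := exists_nat_gt (2 * Real.pi / min d Real.pi)
  have hmin : 0 < min d Real.pi := lt_min hd Real.pi_pos
  have hn0 : (0:ℝ) < n := (by positivity : 0 < 2 * Real.pi / min d Real.pi).trans hn
  set q : ℝ := 2 * Real.pi / n with hq
  have hq0 : 0 < q := by positivity
  have hqd : q < min d Real.pi := by
    rw [hq, div_lt_iff₀ hn0]; rw [div_lt_iff₀ hmin] at hn; linarith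
  have hnq : n * q = 2 * Real.pi := by rw [hq]; field_simp
  refine ((Finset.range n).finite_toSet.image
    (fun j : ℕ => connectedComponentIn Eᶜ (m (j * q)))).subset ?_
  rintro C ⟨⟨x0, hx0, rfl⟩, hu, hv⟩
  set C := connectedComponentIn Eᶜ x0 with hC
  have hCo : IsOpen C := hE.isOpen_compl.connectedComponentIn
  have hCE : C ⊆ Eᶜ := connectedComponentIn_subset _ _
  suffices hint : ∃ k : ℤ, m (k * q) ∈ C by
    obtain ⟨k, hk⟩ := hint
    have hnz : (n:ℤ) ≠ 0 := by rintro h; rw [Int.natCast_eq_zero] at h; simp [h] at hn0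
    have h1 : 0 ≤ k % n := Int.emod_nonneg _ hnz
    have h2 : k % n < n := Int.emod_lt_of_pos _ (by omega)
    have h3 : m (((k % n).toNat : ℝ) * q) = m (k * q) := by
      have h4 : (((k % n).toNat : ℝ)) = ((k % n : ℤ) : ℝ) := by
        exact_mod_cast Int.toNat_of_nonneg h1
      have h5 : (k:ℝ) = ((k % n : ℤ) : ℝ) + n * ((k / n : ℤ) : ℝ) := by
        exact_mod_cast (Int.emod_add_mul_ediv k n).symm
      have h6 := hper.zsmul (k / n) (((k % n : ℤ) : ℝ) * q)
      rw [h4, ← h6, h5, zsmul_eq_mul, ← hnq]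
      congr 1; ring
    refine ⟨(k % n).toNat, by simp; omega, ?_⟩
    change connectedComponentIn Eᶜ (m (((k % n).toNat : ℝ) * q)) = _
    rw [h3]
    exact (connectedComponentIn_eq hk).symm
  -- the logarithm
  obtain ⟨L, hL, hL'⟩ := exists_log haN hac hinj hinf hρ hCo isPreconnected_connectedComponentIn hu hv
  set K := {x | x ∉ C ∧ ρ ≤ ‖a x‖ ∧ ‖a x‖ ≤ R} with hK
  set T := {t | m t ∉ C} with hT
  have hTc : IsClosed T := (hCo.preimage hm).isClosed_compl
  have hTK : ∀ t ∈ T, m t ∈ K := fun t ht => ⟨ht, by rw [hnm]; exact hρc.le, by rw [hnm]; exact hcR.le⟩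
  rcases T.eq_empty_or_nonempty with hTe | ⟨t0, ht0⟩
  · refine ⟨0, ?_⟩
    by_contra h
    exact (eq_empty_iff_forall_notMem.1 hTe) _ h
  let g : ℝ → ℂ := fun t => L (m t) - Complex.log c - t * Complex.I
  have hg : ContinuousOn g T :=
    ((hL.comp hm.continuousOn hTK).sub continuousOn_const).sub (by fun_prop)
  have hcC : (c:ℂ) ≠ 0 := by exact_mod_cast hc.ne'
  have hg1 : ∀ t ∈ T, Complex.exp (g t) = 1 := fun t ht => by
    simp only [g]
    rw [Complex.exp_sub, Complex.exp_sub, hL' _ (hTK t ht), Complex.exp_log hcC, ham,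
      mul_div_cancel_left₀ _ hcC, div_self (Complex.exp_ne_zero _)]
  obtain ⟨s, s', hss, hs, hs', hgap, hne⟩ := exists_gap hTc hg hg1
    (t0 := t0) (t1 := t0 + 2 * Real.pi) (by linarith [Real.pi_pos]) ht0
    (by simp only [hT, mem_ofPred_eq, hper t0]; exact ht0)
    (by
      simp only [g, hper t0]
      intro h
      have h2 := congrArg Complex.im h
      simp at h2)
  have hgap' : ∀ t ∈ Ioo s s', m t ∈ C := fun t ht => not_not.1 (hgap t ht)
  -- large gap gives the grid point
  by_cases hlen : q < s' - s
  · refine ⟨⌊s / q⌋ + 1, hgap' _ ?_⟩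
    have h1 := Int.lt_floor_add_one (s / q)
    have h2 := Int.floor_le (s / q)
    rw [div_lt_iff₀ hq0] at h1
    rw [le_div_iff₀ hq0] at h2
    push_cast
    constructor <;> nlinarith
  exfalso
  apply hne
  have hlen' : s' - s < min d Real.pi := (not_lt.1 hlen).trans_lt hqd
  have hcl : ∀ t ∈ closure (Ioo s s'), m t ∈ closure C := fun t ht =>
    map_mem_closure hm ht hgap'
  rw [closure_Ioo hss.ne] at hcl
  have hfr : ∀ x ∈ closure C, x ∉ C → x ∈ E := by
    intro x hx hxC
    by_contra hxE
    apply hxC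
    have hDo : IsOpen (connectedComponentIn Eᶜ x) := hE.isOpen_compl.connectedComponentIn
    obtain ⟨y, hy1, hy2⟩ := mem_closure_iff.1 hx _ hDo (mem_connectedComponentIn hxE)
    have e1 := connectedComponentIn_eq hy1
    have e2 := connectedComponentIn_eq hy2
    rw [hC, e2, ← e1]
    exact mem_connectedComponentIn hxE
  have hsE := hfr _ (hcl s (left_mem_Icc.2 hss.le)) hs
  have hsE' := hfr _ (hcl s' (right_mem_Icc.2 hss.le)) hs'
  have hdist := hdm s s' (by
    rw [abs_sub_comm, abs_of_pos (by linarith)]; exact hlen'.trans_le (min_le_left _ _))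
  obtain ⟨F, hFE, hFc, hF1, hF2, hFη⟩ := hF _ hsE _ hsE' hdist
  have hFa : ∀ x ∈ F, ‖a x - a (m s)‖ < τ := fun x hx => hnear s x (hFη x hx)
  have hFK : F ⊆ K := by
    intro x hx
    have h1 := hFa x hx
    have h2 := abs_norm_sub_norm_le (a x) (a (m s))
    rw [hnm] at h2
    have h3 := abs_le.1 h2
    exact ⟨fun h => hCE h (hFE hx), by linarith, by linarith⟩
  have hFs : ∀ x ∈ F, a x / a (m s) ∈ Complex.slitPlane := fun x hx =>
    slit_ratio (by rw [hnm]; exact (hFa x hx).trans_le hτ1)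
  have ham0 : a (m s) ≠ 0 := by rw [← norm_pos_iff, hnm]; exact hc
  have hFcont : ContinuousOn a F := fun x hx => by
    refine (hat x ?_).continuousWithinAt
    rintro rfl
    have := (hFK hx).2.1
    rw [haN, norm_zero] at this; linarith
  have hcst := const_of_exp_eq hFc (f := fun x => L x - Complex.log (a x / a (m s))) (w := a (m s))
    ((hL.mono hFK).sub ((hFcont.div_const _).clog hFs))
    (fun x hx => by
      have h0 : a x ≠ 0 := by rw [← hL' x (hFK hx)]; exact Complex.exp_ne_zero _
      rw [Complex.exp_sub, hL' x (hFK hx), Complex.exp_log (Complex.slitPlane_ne_zero (hFs x hx))]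
      field_simp) hF1 hF2
  simp only [div_self ham0, Complex.log_one, sub_zero] at hcst
  have hr : a (m s') / a (m s) = Complex.exp (((s' - s : ℝ) : ℂ) * Complex.I) := by
    rw [ham, ham, mul_div_mul_left _ _ hcC, ← Complex.exp_sub]; push_cast; ring_nf
  have hpi := hlen'.trans_le (min_le_right _ _)
  rw [hr, Complex.log_exp (by simp; linarith [Real.pi_pos]) (by simp; linarith)] at hcst
  simp only [g]
  rw [hcst]; push_cast; ring

abbrev Sph := Metric.sphere (0 : EuclideanSpace ℝ (Fin 3)) 1

lemma sph_sq (i : Fin 3) (x : Sph) : x.1 i ^ 2 + x.1 (i + 1) ^ 2 + x.1 (i + 2) ^ 2 = 1 := by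
  have h : ‖x.1‖ = 1 := mem_sphere_zero_iff_norm.1 x.2
  have h2 : ‖x.1‖ ^ 2 = 1 := by rw [h]; norm_num
  rw [EuclideanSpace.norm_sq_eq, Fin.sum_univ_three] at h2
  simp only [Real.norm_eq_abs, sq_abs] at h2
  fin_cases i <;> simp <;> linarith

lemma sph_ext (i : Fin 3) {x y : Sph} (h0 : x.1 i = y.1 i) (h1 : x.1 (i + 1) = y.1 (i + 1))
    (h2 : x.1 (i + 2) = y.1 (i + 2)) : x = y := by
  apply Subtype.ext
  ext j
  fin_cases i <;> fin_cases j <;> simp_all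

lemma sph_mk (i : Fin 3) (u v w : ℝ) (h : u ^ 2 + v ^ 2 + w ^ 2 = 1) :
    WithLp.toLp 2 (fun j : Fin 3 => if j = i then u else if j = i + 1 then v else w) ∈
      Metric.sphere (0 : EuclideanSpace ℝ (Fin 3)) 1 := by
  rw [mem_sphere_zero_iff_norm, EuclideanSpace.norm_eq, Real.sqrt_eq_one, Fin.sum_univ_three]
  simp only [Real.norm_eq_abs, sq_abs]
  fin_cases i <;> simp <;> linarith

noncomputable def aa (i : Fin 3) (x : Sph) : ℂ :=
  (⟨x.1 (i + 1), x.1 (i + 2)⟩ : ℂ) / ((1 - x.1 i : ℝ) : ℂ)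

noncomputable def gg (h : ℝ) : ℝ := √((1 + h) / (1 - h))

lemma gg_lt {h k : ℝ} (hh : -1 ≤ h) (hk : k < 1) (hhk : h < k) : gg h < gg k := by
  apply Real.sqrt_lt_sqrt
  · exact div_nonneg (by linarith) (by linarith)
  · rw [div_lt_div_iff₀ (by linarith) (by linarith)]; nlinarith

lemma aa_norm (i : Fin 3) (x : Sph) (hx : x.1 i < 1) : ‖aa i x‖ = gg (x.1 i) := by
  have h := sph_sq i x
  have h1 : 0 < 1 - x.1 i := by linarith
  rw [gg, ← Real.sqrt_sq (norm_nonneg (aa i x))]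
  congr 1
  rw [aa, norm_div, div_pow, ← Complex.normSq_eq_norm_sq, Complex.normSq_mk, Complex.norm_real,
    Real.norm_of_nonneg h1.le, div_eq_div_iff (by positivity) h1.ne']
  linear_combination (1 - x.1 i) * h

lemma h_le (i : Fin 3) (x : Sph) : -1 ≤ x.1 i ∧ x.1 i ≤ 1 := by
  have h := sph_sq i x
  constructor <;> nlinarith [sq_nonneg (x.1 (i+1)), sq_nonneg (x.1 (i+2))]

noncomputable def NN (i : Fin 3) : Sph := ⟨_, sph_mk i 1 0 0 (by norm_num)⟩

lemma NN_apply (i : Fin 3) : (NN i).1 i = 1 ∧ (NN i).1 (i + 1) = 0 ∧ (NN i).1 (i + 2) = 0 := by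
  fin_cases i <;> simp [NN]

lemma ne_NN (i : Fin 3) (x : Sph) : x ≠ NN i ↔ x.1 i < 1 := by
  obtain ⟨h0, h1, h2⟩ := NN_apply i
  constructor
  · intro h
    refine lt_of_le_of_ne (h_le i x).2 fun h' => h ?_
    have h3 := sph_sq i x
    rw [h'] at h3
    refine sph_ext i (by rw [h', h0]) ?_ ?_
    · rw [h1]; nlinarith [sq_nonneg (x.1 (i+1)), sq_nonneg (x.1 (i+2))]
    · rw [h2]; nlinarith [sq_nonneg (x.1 (i+1)), sq_nonneg (x.1 (i+2))]
  · rintro h rfl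
    linarith

noncomputable def mm (i : Fin 3) (c : ℝ) (hc : c ^ 2 ≤ 1) (t : ℝ) : Sph :=
  ⟨_, sph_mk i c (√(1 - c ^ 2) * Real.cos t) (√(1 - c ^ 2) * Real.sin t) (by
    rw [mul_pow, mul_pow, Real.sq_sqrt (by linarith)]
    nlinarith [Real.sin_sq_add_cos_sq t])⟩

lemma mm_apply (i : Fin 3) (c : ℝ) (hc : c ^ 2 ≤ 1) (t : ℝ) : (mm i c hc t).1 i = c ∧
    (mm i c hc t).1 (i + 1) = √(1 - c ^ 2) * Real.cos t ∧
    (mm i c hc t).1 (i + 2) = √(1 - c ^ 2) * Real.sin t := by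
  fin_cases i <;> simp [mm]

lemma mm_cont (i : Fin 3) (c : ℝ) (hc : c ^ 2 ≤ 1) : Continuous (mm i c hc) := by
  refine Continuous.subtype_mk ((PiLp.continuous_toLp 2 _).comp (continuous_pi fun j => ?_)) _
  split_ifs <;> fun_prop

lemma coord_cont (j : Fin 3) : Continuous (fun x : Sph => x.1 j) := by fun_prop

lemma aa_cont (i : Fin 3) : ContinuousOn (aa i) {NN i}ᶜ := by
  intro x hx
  have hx' : x.1 i < 1 := (ne_NN i x).1 hx
  apply ContinuousAt.continuousWithinAt
  have e : aa i = fun x : Sph => ((x.1 (i + 1) : ℂ) + (x.1 (i + 2) : ℂ) * Complex.I) /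
      ((1 - x.1 i : ℝ) : ℂ) := by
    funext x; rw [aa, Complex.mk_eq_add_mul_I]
  rw [e]
  have := coord_cont (i + 1)
  have := coord_cont (i + 2)
  have := coord_cont i
  refine ContinuousAt.div (by fun_prop) (by fun_prop) ?_
  exact Complex.ofReal_ne_zero.2 (by linarith)

lemma aa_inj (i : Fin 3) : InjOn (aa i) {NN i}ᶜ := by
  intro x hx y hy h
  have hx' : x.1 i < 1 := (ne_NN i x).1 hx
  have hy' : y.1 i < 1 := (ne_NN i y).1 hy
  have hn : gg (x.1 i) = gg (y.1 i) := by rw [← aa_norm i x hx', ← aa_norm i y hy', h]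
  have h0 : x.1 i = y.1 i := by
    rcases lt_trichotomy (x.1 i) (y.1 i) with hl | hl | hl
    · exact absurd hn (gg_lt (h_le i x).1 hy' hl).ne
    · exact hl
    · exact absurd hn (gg_lt (h_le i y).1 hx' hl).ne'
  have hne : ((1 - y.1 i : ℝ) : ℂ) ≠ 0 := by exact Complex.ofReal_ne_zero.2 (by linarith)
  rw [aa, aa, h0, div_left_inj' hne] at h
  exact sph_ext i h0 (congrArg Complex.re h) (congrArg Complex.im h)

lemma aa_inf (i : Fin 3) (R : ℝ) : ∀ᶠ x in 𝓝[≠] (NN i), R < ‖aa i x‖ := by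
  obtain ⟨h0, -, -⟩ := NN_apply i
  have hlt : max 0 (1 - 1 / (R ^ 2 + 1)) < (NN i).1 i := by
    rw [h0]
    have : 0 < 1 / (R ^ 2 + 1) := by positivity
    exact max_lt one_pos (by linarith)
  have h := (coord_cont i).continuousAt.eventually_const_lt hlt
  filter_upwards [nhdsWithin_le_nhds h, self_mem_nhdsWithin] with x hx hxN
  have hx' : x.1 i < 1 := (ne_NN i x).1 hxN
  obtain ⟨h1, h2⟩ := max_lt_iff.1 hx
  rw [aa_norm i x hx', gg]
  apply Real.lt_sqrt_of_sq_lt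
  rw [lt_div_iff₀ (by linarith)]
  have h3 : 1 - x.1 i < 1 / (R ^ 2 + 1) := by linarith
  rw [lt_div_iff₀ (by positivity)] at h3
  nlinarith

lemma aa_mm (i : Fin 3) (c : ℝ) (hc : c ^ 2 ≤ 1) (hc0 : -1 < c) (hc1 : c < 1) (t : ℝ) :
    aa i (mm i c hc t) = (gg c : ℝ) * Complex.exp (t * Complex.I) := by
  obtain ⟨h0, h1, h2⟩ := mm_apply i c hc t
  have hg : gg c = √(1 - c ^ 2) / (1 - c) := by
    rw [gg, Real.sqrt_eq_iff_eq_sq (div_nonneg (by linarith) (by linarith))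
      (div_nonneg (Real.sqrt_nonneg _) (by linarith)), div_pow, Real.sq_sqrt (by linarith)]
    have : 1 - c ≠ 0 := by linarith
    field_simp
    ring
  rw [aa, h0, h1, h2, hg, Complex.exp_mul_I, Complex.mk_eq_add_mul_I]
  push_cast
  ring

lemma slab_finite (i : Fin 3) {α c β : ℝ} (hα : -1 < α) (hαc : α < c) (hcβ : c < β) (hβ : β < 1)
    {E : Set Sph} (hE : IsClosed E) (hlc : LocallyConnectedSpace E) :
    {C : Set Sph | (∃ x ∈ Eᶜ, C = connectedComponentIn Eᶜ x) ∧
      (∃ u ∈ C, u.1 i < α) ∧ (∃ v ∈ C, β < v.1 i)}.Finite := by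
  have : Fact (Module.finrank ℝ (EuclideanSpace ℝ (Fin 3)) = 2 + 1) := ⟨by simp⟩
  have : LocallyConnectedSpace Sph :=
    ChartedSpace.locallyConnectedSpace (EuclideanSpace ℝ (Fin 2)) _
  have : CompactSpace Sph := isCompact_iff_compactSpace.1 (isCompact_sphere _ _)
  have hc : c ^ 2 ≤ 1 := by nlinarith
  obtain ⟨hN0, hN1, hN2⟩ := NN_apply i
  refine (core (a := aa i) (N := NN i) (by rw [aa, hN0]; simp) (aa_cont i) (aa_inj i) (aa_inf i)
    (ρ := gg α) (c := gg c) (R := gg β)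
    (Real.sqrt_pos.2 (div_pos (by linarith) (by linarith)))
    (gg_lt hα.le (by linarith) hαc) (gg_lt (by linarith) hβ hcβ) (mm_cont i c hc)
    (aa_mm i c hc (by linarith) (by linarith)) hE hlc).subset ?_
  rintro C ⟨h1, ⟨u, hu, hu'⟩, ⟨v, hv, hv'⟩⟩
  refine ⟨h1, ⟨u, hu, (ne_NN i u).2 (by linarith), ?_⟩, ⟨v, hv, ?_⟩⟩
  · rw [aa_norm i u (by linarith)]
    exact gg_lt (h_le i u).1 (by linarith) hu'
  · by_cases h : v = NN i
    · exact Or.inl h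
    · right
      have h := (ne_NN i v).1 h
      rw [aa_norm i v h]
      exact gg_lt (by linarith) h hv'

/-- Whyburn's criterion, one direction: a closed, connected,
locally connected subset `E` of the (round) sphere has, for each `ε > 0`,
only finitely many complementary components of spherical diameter exceeding `ε`. -/
theorem stmt_6 (E : Set (Metric.sphere (0 : EuclideanSpace ℝ (Fin 3)) 1))
    (hclosed : IsClosed E) (hconn : IsConnected E)
    (hlc : LocallyConnectedSpace E) :
    ∀ ε > (0 : ℝ),
      {C : Set (Metric.sphere (0 : EuclideanSpace ℝ (Fin 3)) 1) |
        (∃ x ∈ Eᶜ, C = connectedComponentIn Eᶜ x) ∧ ε < Metric.diam C}.Finite := by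
  intro ε hε
  set d : ℝ := ε / 8 with hd
  have hd0 : 0 < d := by positivity
  have hfin : {k : ℤ | -1 < k * d ∧ (k + 2) * d < 1}.Finite := by
    refine (Set.finite_Icc ⌊-1 / d⌋ ⌈1 / d⌉).subset ?_
    rintro k ⟨h1, h2⟩
    constructor
    · have : ((⌊-1 / d⌋ : ℤ) : ℝ) ≤ k :=
        (Int.floor_le _).trans (by rw [div_le_iff₀ hd0]; exact h1.le)
      exact_mod_cast this
    · have : (k : ℝ) ≤ (⌈1 / d⌉ : ℤ) :=
        le_trans (by rw [le_div_iff₀ hd0]; nlinarith) (Int.le_ceil _)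
      exact_mod_cast this
  have hbig := (Set.finite_univ (α := Fin 3)).biUnion fun i _ => hfin.biUnion
    (t := fun k => {C : Set Sph | (∃ x ∈ Eᶜ, C = connectedComponentIn Eᶜ x) ∧
      (∃ u ∈ C, u.1 i < k * d) ∧ (∃ v ∈ C, (k + 2) * d < v.1 i)})
    fun k hk => slab_finite i (c := (k + 1) * d) hk.1 (by nlinarith) (by nlinarith) hk.2 hclosed hlc
  refine hbig.subset ?_
  rintro C ⟨hC, hdiam⟩
  obtain ⟨x, hx, y, hy, hxy⟩ : ∃ x ∈ C, ∃ y ∈ C, ε < dist x y := by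
    by_contra! h
    exact absurd (Metric.diam_le_of_forall_dist_le hε.le h) (not_le.2 hdiam)
  obtain ⟨i, hi⟩ : ∃ i : Fin 3, ε / 2 < |x.1 i - y.1 i| := by
    by_contra! h
    have h1 : dist x y ^ 2 = ∑ i : Fin 3, (x.1 i - y.1 i) ^ 2 := by
      rw [Subtype.dist_eq, EuclideanSpace.dist_eq, Real.sq_sqrt (by positivity)]
      simp [Real.dist_eq]
    have h2 : ∀ i, (x.1 i - y.1 i) ^ 2 ≤ (ε / 2) ^ 2 := fun i => by
      rw [← sq_abs]; exact pow_le_pow_left₀ (abs_nonneg _) (h i) 2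
    rw [Fin.sum_univ_three] at h1
    nlinarith [h2 0, h2 1, h2 2]
  obtain ⟨u, hu, v, hv, huv⟩ : ∃ u ∈ C, ∃ v ∈ C, ε / 2 < v.1 i - u.1 i := by
    rcases lt_abs.1 hi with h | h
    · exact ⟨y, hy, x, hx, h⟩
    · exact ⟨x, hx, y, hy, by linarith⟩
  have h1 := Int.lt_floor_add_one (u.1 i / d)
  have h2 := Int.floor_le (u.1 i / d)
  rw [div_lt_iff₀ hd0] at h1
  rw [le_div_iff₀ hd0] at h2
  have hu1 := (h_le i u).1
  have hv1 := (h_le i v).2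
  simp only [mem_iUnion]
  refine ⟨i, mem_univ _, ⌊u.1 i / d⌋ + 1, ⟨?_, ?_⟩, hC, ⟨u, hu, ?_⟩, ⟨v, hv, ?_⟩⟩ <;>
    push_cast <;> linarith
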